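/- Let d ≥ 1 and for each n ∈ ℕ let F_n and G_n be continuous dfs of Borel probability measures ρ_n and τ_n on [0,∞)^d, such that lim_{n→∞} F_n(x₁,…,x_d)^n = H(x₁,…,x_d) and lim_{n→∞} G_n(x₁,…,x_d)^n = Q(x₁,…,x_d) for every (x₁,…,x_d) ∈ [0,∞)^d, where H and Q are max-infinitely divisible dfs with unit Fréchet marginals. Let υ be an exponent measure of H. Assume there exist C₁ > 0 and N such that for all n ≥ N and all (x₁,…,x_d) ∈ (0,∞)^d: G_n(x₁,…,x_d)^n ≤ C₁ Σ_{i=1}^d F_{ni}(x_i)^n, where F_{ni} is the i-th marginal df of F_n. Then lim_{n→∞} n ∫_{[0,∞)^d} G_n(x₁,…,x_d)^n dρ_n(x) = ∫_{(0,∞)^d} Q(x₁,…,x_d) dυ(x). -/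

import Mathlib

open MeasureTheory Filter Topology ProbabilityTheory
open scoped ENNReal
/-- The unit Fréchet distribution function `Φ(x) = exp(-1/x)` for `x > 0`, `0` otherwise. -/
noncomputable def frechet (x : ℝ) : ℝ := if 0 < x then Real.exp (-(1/x)) else 0

/-- The distribution function of a Borel measure on `ℝ^d`. -/
noncomputable def df {d : ℕ} (ρ : Measure (Fin d → ℝ)) (x : Fin d → ℝ) : ℝ :=
  (ρ {y | ∀ i, y i ≤ x i}).toReal

/-- The `i`-th marginal distribution function of a Borel measure on `ℝ^d`. -/
noncomputable def marg {d : ℕ} (ρ : Measure (Fin d → ℝ)) (i : Fin d) (t : ℝ) : ℝ :=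
  (ρ {y | y i ≤ t}).toReal

/-- All one-dimensional marginal dfs equal the unit Fréchet df. -/
def HasFrechetMarginals {d : ℕ} (ρ : Measure (Fin d → ℝ)) : Prop :=
  ∀ (i : Fin d) (t : ℝ), marg ρ i t = frechet t

/-- The measure is concentrated on `[0,∞)^d`. -/
def SupportedOnNonneg {d : ℕ} (ρ : Measure (Fin d → ℝ)) : Prop :=
  ρ {y | ∃ i, y i < 0} = 0

/-- Max-infinite divisibility: for every `t > 0`, `H^t` is again a df of a Borel
probability measure. -/
def MaxID {d : ℕ} (ρ : Measure (Fin d → ℝ)) : Prop :=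
  ∀ t : ℝ, 0 < t → ∃ ν : Measure (Fin d → ℝ), IsProbabilityMeasure ν ∧
    ∀ x, df ν x = (df ρ x) ^ t

/-- Max-stability (for a df with unit Fréchet marginals):
`H(t x₁, …, t x_d) = H(x₁, …, x_d)^(1/t)` for all `t > 0` and `x ∈ (0,∞)^d`. -/
def MaxStable {d : ℕ} (ρ : Measure (Fin d → ℝ)) : Prop :=
  ∀ t : ℝ, 0 < t → ∀ x : Fin d → ℝ, (∀ i, 0 < x i) →
    df ρ (fun i => t * x i) = (df ρ x) ^ (1/t)

/-- `υ` is an exponent measure of the max-id df of `ρ`: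
`υ{y : y_i > x_i for some i} = -ln H(x)` for all `x ∈ (0,∞)^d`. -/
def IsExponentMeasure {d : ℕ} (ρ υ : Measure (Fin d → ℝ)) : Prop :=
  ∀ x : Fin d → ℝ, (∀ i, 0 < x i) →
    (υ {y | ∃ i, x i < y i}).toReal = - Real.log (df ρ x)

/-- The positive orthant `(0,∞)^d`. -/
def posOrthant (d : ℕ) : Set (Fin d → ℝ) := {x | ∀ i, 0 < x i}

/-- `F` is in the max-domain of attraction of `H` with norming constants `a_n = n`:
`F(n x)^n → H(x)` for every `x ∈ (0,∞)^d`. -/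
def MDA {d : ℕ} (ρ ρH : Measure (Fin d → ℝ)) : Prop :=
  ∀ x : Fin d → ℝ, (∀ i, 0 < x i) →
    Tendsto (fun n : ℕ => (df ρ (fun i => (n : ℝ) * x i)) ^ n) atTop (𝓝 (df ρH x))

/-- Convergence of integrals over a box: if the (rescaled) masses of all half-open subboxes converge
and monotone integrands converge pointwise to a continuous limit, then the (rescaled)
integrals converge. -/
theorem tendsto_setIntegral_box {ι : Type*} [Fintype ι] (I : BoxIntegral.Box ι)
    (c : ℕ → ℝ) (hc : ∀ n, 0 ≤ c n) (μ : ℕ → Measure (ι → ℝ)) [∀ n, IsFiniteMeasure (μ n)]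
    (υ : Measure (ι → ℝ)) (hυ : υ I ≠ ∞) (g : ℕ → (ι → ℝ) → ℝ) (q : (ι → ℝ) → ℝ)
    (hgm : ∀ n, Monotone (g n)) (hgi : ∀ n, IntegrableOn (g n) I (μ n))
    (hqm : Monotone q) (hqc : Continuous q)
    (hgq : ∀ x ∈ BoxIntegral.Box.Icc I, Tendsto (fun n => g n x) atTop (𝓝 (q x)))
    (hμ : ∀ J ≤ I, Tendsto (fun n => c n * (μ n).real J) atTop (𝓝 (υ.real J))) :
    Tendsto (fun n => c n * ∫ x in I, g n x ∂(μ n)) atTop (𝓝 (∫ x in I, q x ∂υ)) := by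
  have hυJ : ∀ J ≤ I, υ J ≠ ∞ := fun J hJ => ne_top_of_le_ne_top hυ (measure_mono hJ)
  have hqi : ∀ J ≤ I, IntegrableOn q J υ := by
    intro J hJ
    have : IntegrableOn q (Set.Icc I.lower I.upper) (υ.restrict J) := by
      have : IsFiniteMeasure (υ.restrict J) :=
        ⟨by simpa using (hυJ J hJ).lt_top⟩
      exact hqc.continuousOn.integrableOn_compact isCompact_Icc
    have hsub : (J : Set (ι → ℝ)) ⊆ Set.Icc I.lower I.upper :=
      J.coe_subset_Icc.trans (BoxIntegral.Box.le_iff_Icc.1 hJ)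
    rw [IntegrableOn, Measure.restrict_restrict measurableSet_Icc,
      Set.inter_eq_right.2 hsub] at this
    exact this
  -- the two-sided approximation on boxes, up to an error `δ` per unit of mass
  have key : ∀ δ > 0, ∃ l u : ℕ → ℝ, ∃ L U : ℝ, Tendsto l atTop (𝓝 L) ∧ Tendsto u atTop (𝓝 U) ∧
      (∀ n, l n ≤ c n * ∫ x in I, g n x ∂(μ n)) ∧ (∀ n, c n * ∫ x in I, g n x ∂(μ n) ≤ u n) ∧
      (∫ x in I, q x ∂υ) - δ * υ.real I ≤ L ∧ U ≤ (∫ x in I, q x ∂υ) + δ * υ.real I := by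
    intro δ hδ
    suffices H : I ≤ I → ∃ l u : ℕ → ℝ, ∃ L U : ℝ,
        Tendsto l atTop (𝓝 L) ∧ Tendsto u atTop (𝓝 U) ∧
        (∀ n, l n ≤ c n * ∫ x in I, g n x ∂(μ n)) ∧ (∀ n, c n * ∫ x in I, g n x ∂(μ n) ≤ u n) ∧
        (∫ x in I, q x ∂υ) - δ * υ.real I ≤ L ∧ U ≤ (∫ x in I, q x ∂υ) + δ * υ.real I from
      H le_rfl
    refine BoxIntegral.Box.subbox_induction_on (p := fun J => J ≤ I → ∃ l u : ℕ → ℝ, ∃ L U : ℝ,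
        Tendsto l atTop (𝓝 L) ∧ Tendsto u atTop (𝓝 U) ∧
        (∀ n, l n ≤ c n * ∫ x in J, g n x ∂(μ n)) ∧ (∀ n, c n * ∫ x in J, g n x ∂(μ n) ≤ u n) ∧
        (∫ x in J, q x ∂υ) - δ * υ.real J ≤ L ∧ U ≤ (∫ x in J, q x ∂υ) + δ * υ.real J) I ?_ ?_
    · intro J _ hsub hJI
      set P := BoxIntegral.Prepartition.splitCenter J
      have hPle : ∀ J' ∈ P.boxes, J' ≤ I := fun J' h => (P.le_of_mem h).trans hJI
      have hU : (J : Set (ι → ℝ)) = ⋃ J' ∈ P.boxes, (J' : Set (ι → ℝ)) :=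
        ((BoxIntegral.Prepartition.isPartition_splitCenter J).iUnion_eq).symm
      have hdisj : (P.boxes : Set (BoxIntegral.Box ι)).PairwiseDisjoint
          (fun J' => (J' : Set (ι → ℝ))) := P.pairwiseDisjoint
      have hmeas : ∀ J' ∈ P.boxes, MeasurableSet (J' : Set (ι → ℝ)) :=
        fun J' _ => J'.measurableSet_coe
      have hintg : ∀ n, ∫ x in J, g n x ∂(μ n) = ∑ J' ∈ P.boxes, ∫ x in J', g n x ∂(μ n) := by
        intro n
        rw [hU, integral_biUnion_finset _ hmeas hdisj]
        exact fun J' h => (hgi n).mono_set (hPle J' h)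
      have hintq : ∫ x in J, q x ∂υ = ∑ J' ∈ P.boxes, ∫ x in J', q x ∂υ := by
        rw [hU, integral_biUnion_finset _ hmeas hdisj]
        exact fun J' h => hqi J' (hPle J' h)
      have hυs : υ.real J = ∑ J' ∈ P.boxes, υ.real J' := by
        rw [hU, measureReal_biUnion_finset hdisj hmeas fun J' h => hυJ J' (hPle J' h)]
      have hsub' : ∀ J' : P.boxes, _ := fun J' => hsub J'.1 J'.2 (hPle J'.1 J'.2)
      choose l u L U hl hu hlb hub hL hU using hsub'
      refine ⟨fun n => ∑ J' : P.boxes, l J' n, fun n => ∑ J' : P.boxes, u J' n, ∑ J' : P.boxes, L J',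
        ∑ J' : P.boxes, U J', tendsto_finsetSum _ fun J' _ => hl J',
        tendsto_finsetSum _ fun J' _ => hu J', fun n => ?_, fun n => ?_, ?_, ?_⟩
      · rw [hintg, Finset.mul_sum, ← Finset.sum_coe_sort P.boxes]
        exact Finset.sum_le_sum fun J' _ => hlb J' n
      · rw [hintg, Finset.mul_sum, ← Finset.sum_coe_sort P.boxes]
        exact Finset.sum_le_sum fun J' _ => hub J' n
      · rw [hintq, hυs, Finset.mul_sum, ← Finset.sum_sub_distrib, ← Finset.sum_coe_sort P.boxes]
        exact Finset.sum_le_sum fun J' _ => hL J'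
      · rw [hintq, hυs, Finset.mul_sum, ← Finset.sum_add_distrib, ← Finset.sum_coe_sort P.boxes]
        exact Finset.sum_le_sum fun J' _ => hU J'
    · intro z _
      have hev : ∀ᶠ x in 𝓝 z, |q x - q z| < δ / 2 := by
        have := hqc.continuousAt.eventually (Metric.ball_mem_nhds (q z) (half_pos hδ))
        simpa [Metric.mem_ball, Real.dist_eq] using this
      refine ⟨{x | |q x - q z| < δ / 2}, mem_nhdsWithin_of_mem_nhds hev, ?_⟩
      intro J hJ _ _ hJU _ _
      have hlo : |q J.lower - q z| < δ / 2 := hJU (Set.left_mem_Icc.2 J.lower_le_upper)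
      have hup : |q J.upper - q z| < δ / 2 := hJU (Set.right_mem_Icc.2 J.lower_le_upper)
      have hosc : q J.upper - q J.lower ≤ δ := by
        rw [abs_lt] at hlo hup; linarith
      have hJI := BoxIntegral.Box.le_iff_Icc.1 hJ
      have hxJ : ∀ x ∈ (J : Set (ι → ℝ)), J.lower ≤ x ∧ x ≤ J.upper := fun x hx => J.coe_subset_Icc hx
      have hconst : ∀ (m : Measure (ι → ℝ)) (r : ℝ), ∫ _ in J, r ∂m = r * m.real J := by
        intro m r; rw [setIntegral_const, smul_eq_mul, mul_comm]
      refine ⟨fun n => g n J.lower * (c n * (μ n).real J), fun n => g n J.upper * (c n * (μ n).real J),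
        q J.lower * υ.real J, q J.upper * υ.real J,
        (hgq _ (hJI (Set.left_mem_Icc.2 J.lower_le_upper))).mul (hμ J hJ),
        (hgq _ (hJI (Set.right_mem_Icc.2 J.lower_le_upper))).mul (hμ J hJ), ?_, ?_, ?_, ?_⟩
      · intro n
        beta_reduce
        rw [mul_left_comm, ← hconst]
        refine mul_le_mul_of_nonneg_left ?_ (hc n)
        exact setIntegral_mono_on (integrableOn_const (by finiteness)) ((hgi n).mono_set hJ)
          J.measurableSet_coe fun x hx => hgm n (hxJ x hx).1
      · intro n
        beta_reduce
        rw [mul_left_comm, ← hconst]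
        refine mul_le_mul_of_nonneg_left ?_ (hc n)
        exact setIntegral_mono_on ((hgi n).mono_set hJ) (integrableOn_const (by finiteness))
          J.measurableSet_coe fun x hx => hgm n (hxJ x hx).2
      · have : ∫ x in J, q x ∂υ ≤ q J.upper * υ.real J := by
          rw [← hconst]
          exact setIntegral_mono_on (hqi J hJ) (integrableOn_const (hυJ J hJ))
            J.measurableSet_coe fun x hx => hqm (hxJ x hx).2
        nlinarith [measureReal_nonneg (μ := υ) (s := J)]
      · have : q J.lower * υ.real J ≤ ∫ x in J, q x ∂υ := by
          rw [← hconst]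
          exact setIntegral_mono_on (integrableOn_const (hυJ J hJ)) (hqi J hJ)
            J.measurableSet_coe fun x hx => hqm (hxJ x hx).1
        nlinarith [measureReal_nonneg (μ := υ) (s := J)]
  rw [Metric.tendsto_atTop']
  intro η hη
  set s := υ.real I
  have hs : 0 ≤ s := measureReal_nonneg
  have hδs : η / (2 * (s + 1)) * s < η := by
    rw [div_mul_eq_mul_div, div_lt_iff₀ (by positivity)]
    nlinarith
  obtain ⟨l, u, L, U, hl, hu, hlb, hub, hL, hU⟩ := key (η / (2 * (s + 1))) (by positivity)
  obtain ⟨n₀, hn₀⟩ := eventually_atTop.1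
    ((hl.eventually_const_lt (by linarith : (∫ x in I, q x ∂υ) - η < L)).and
      (hu.eventually_lt_const (by linarith : U < (∫ x in I, q x ∂υ) + η)))
  refine ⟨n₀, fun n hn => ?_⟩
  obtain ⟨h1, h2⟩ := hn₀ n hn.le
  rw [Real.dist_eq, abs_lt]
  constructor <;> linarith [hlb n, hub n]

theorem frechet_eq_expNegInvGlue : frechet = expNegInvGlue := by
  ext x
  by_cases hx : 0 < x
  · simp [frechet, expNegInvGlue, hx, not_le.2 hx]
  · simp [frechet, expNegInvGlue, hx, not_lt.1 hx]

theorem continuous_frechet : Continuous frechet :=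
  frechet_eq_expNegInvGlue ▸ (expNegInvGlue.contDiff (n := 0)).continuous

theorem frechet_pos {x : ℝ} (hx : 0 < x) : 0 < frechet x := by
  rw [frechet, if_pos hx]; positivity

theorem frechet_lt_one (x : ℝ) : frechet x < 1 := by
  rw [frechet]
  split_ifs with hx
  · rw [Real.exp_lt_one_iff]
    simpa using hx
  · exact one_pos

theorem tendsto_frechet_atTop : Tendsto frechet atTop (𝓝 1) := by
  have h : Tendsto (fun x : ℝ => Real.exp (-(1 / x))) atTop (𝓝 1) := by
    have := (Real.continuous_exp.tendsto 0).comp (by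
      simpa using (tendsto_inv_atTop_zero (𝕜 := ℝ)).neg : Tendsto (fun x : ℝ => -(1 / x)) atTop (𝓝 0))
    simpa [Function.comp_def] using this
  refine h.congr' ?_
  filter_upwards [eventually_gt_atTop 0] with x hx
  rw [frechet, if_pos hx]

section DistributionFunctions

variable {d : ℕ} {ρ : Measure (Fin d → ℝ)}

theorem df_eq_measureReal_Iic (ρ : Measure (Fin d → ℝ)) (x : Fin d → ℝ) :
    df ρ x = ρ.real (Set.Iic x) := rfl

theorem marg_eq_measureReal (ρ : Measure (Fin d → ℝ)) (i : Fin d) (t : ℝ) :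
    marg ρ i t = ρ.real {y | y i ≤ t} := rfl

theorem measurableSet_exists_lt (x : Fin d → ℝ) : MeasurableSet {y : Fin d → ℝ | ∃ i, x i < y i} := by
  rw [Set.ofPred_exists]
  exact MeasurableSet.iUnion fun i => measurableSet_lt measurable_const (measurable_pi_apply i)

theorem df_nonneg (ρ : Measure (Fin d → ℝ)) (x : Fin d → ℝ) : 0 ≤ df ρ x := measureReal_nonneg

theorem marg_nonneg (ρ : Measure (Fin d → ℝ)) (i : Fin d) (t : ℝ) : 0 ≤ marg ρ i t :=
  measureReal_nonneg

variable [IsProbabilityMeasure ρ]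

theorem df_le_one (x : Fin d → ℝ) : df ρ x ≤ 1 := measureReal_le_one

theorem marg_le_one (i : Fin d) (t : ℝ) : marg ρ i t ≤ 1 := measureReal_le_one

theorem df_mono : Monotone (df ρ) := fun _ _ h => measureReal_mono (Set.Iic_subset_Iic.2 h)

theorem marg_mono (i : Fin d) : Monotone (marg ρ i) :=
  fun _ _ h => measureReal_mono fun _ hy => le_trans hy h

theorem df_le_marg (x : Fin d → ℝ) (i : Fin d) : df ρ x ≤ marg ρ i (x i) :=
  measureReal_mono fun _ hy => hy i

theorem measureReal_exists_lt (x : Fin d → ℝ) : ρ.real {y | ∃ i, x i < y i} = 1 - df ρ x := by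
  have : {y : Fin d → ℝ | ∃ i, x i < y i} = (Set.Iic x)ᶜ := by
    ext y; simp [Pi.le_def]
  rw [this, probReal_compl_eq_one_sub measurableSet_Iic, df_eq_measureReal_Iic]

theorem measureReal_lt_eval (i : Fin d) (t : ℝ) : ρ.real {y | t < y i} = 1 - marg ρ i t := by
  have : {y : Fin d → ℝ | t < y i} = {y | y i ≤ t}ᶜ := by ext y; simp
  rw [this, probReal_compl_eq_one_sub (measurableSet_le (measurable_pi_apply i) measurable_const),
    marg_eq_measureReal]

theorem one_sub_df_le (x : Fin d → ℝ) : 1 - df ρ x ≤ ∑ i, (1 - marg ρ i (x i)) := by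
  simp_rw [← measureReal_exists_lt, ← measureReal_lt_eval]
  rw [Set.ofPred_exists]
  exact measureReal_iUnion_fintype_le _

theorem df_le_add_sum_abs (x y : Fin d → ℝ) :
    df ρ x ≤ df ρ y + ∑ i, |marg ρ i (x i) - marg ρ i (y i)| := by
  have hsub : Set.Iic x ⊆ Set.Iic y ∪ ⋃ i, ({z | z i ≤ x i} \ {z | z i ≤ y i}) := by
    intro z hz
    by_cases h : z ≤ y
    · exact Or.inl h
    · obtain ⟨i, hi⟩ := not_forall.1 h
      exact Or.inr (Set.mem_iUnion.2 ⟨i, hz i, hi⟩)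
  have hdiff : ∀ i, ρ.real ({z | z i ≤ x i} \ {z | z i ≤ y i}) ≤
      |marg ρ i (x i) - marg ρ i (y i)| := by
    intro i
    rcases le_total (x i) (y i) with h | h
    · have : ({z : Fin d → ℝ | z i ≤ x i} \ {z | z i ≤ y i}) = ∅ :=
        Set.sdiff_eq_empty.2 fun z hz => le_trans hz h
      simp [this]
    · have hle : {z : Fin d → ℝ | z i ≤ y i} ⊆ {z | z i ≤ x i} := fun z hz => le_trans hz h
      rw [measureReal_sdiff hle (measurableSet_le (measurable_pi_apply i) measurable_const)]
      exact le_abs_self _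
  calc df ρ x ≤ ρ.real (Set.Iic y ∪ ⋃ i, ({z | z i ≤ x i} \ {z | z i ≤ y i})) :=
        measureReal_mono hsub
    _ ≤ _ := (measureReal_union_le _ _).trans (add_le_add le_rfl
        ((measureReal_iUnion_fintype_le _).trans (Finset.sum_le_sum fun i _ => hdiff i)))

theorem continuous_df_of_continuous_marg (h : ∀ i, Continuous (marg ρ i)) : Continuous (df ρ) := by
  rw [continuous_iff_continuousAt]
  intro x
  have hs : Tendsto (fun y : Fin d → ℝ => ∑ i, |marg ρ i (y i) - marg ρ i (x i)|) (𝓝 x) (𝓝 0) := by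
    have : Continuous fun y : Fin d → ℝ => ∑ i, |marg ρ i (y i) - marg ρ i (x i)| :=
      continuous_finsetSum _ fun i _ =>
        (((h i).comp (continuous_apply i)).sub continuous_const).abs
    simpa using this.tendsto x
  rw [ContinuousAt, tendsto_iff_dist_tendsto_zero]
  refine squeeze_zero (fun _ => dist_nonneg) (fun y => ?_) hs
  rw [Real.dist_eq, abs_sub_le_iff]
  have h1 := df_le_add_sum_abs (ρ := ρ) x y
  simp_rw [abs_sub_comm (marg ρ _ (x _))] at h1
  exact ⟨by linarith [df_le_add_sum_abs (ρ := ρ) y x], by linarith⟩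

theorem tendsto_df_update (i : Fin d) (t : ℝ) :
    Tendsto (fun m : ℕ => df ρ (Function.update (fun _ => (m : ℝ)) i t)) atTop
      (𝓝 (marg ρ i t)) := by
  have hmono : Monotone fun m : ℕ => Set.Iic (Function.update (fun _ : Fin d => (m : ℝ)) i t) := by
    intro m n hmn
    exact Set.Iic_subset_Iic.2 (update_le_update_iff.2 ⟨le_rfl, fun _ _ => Nat.cast_le.2 hmn⟩)
  have hU : ⋃ m : ℕ, Set.Iic (Function.update (fun _ : Fin d => (m : ℝ)) i t) = {y | y i ≤ t} := by
    ext y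
    simp only [Set.mem_iUnion, Set.mem_Iic, Set.mem_ofPred_eq, le_update_iff]
    refine ⟨fun ⟨m, h⟩ => h.1, fun h => ?_⟩
    obtain ⟨m, hm⟩ := exists_nat_ge (∑ j, |y j|)
    exact ⟨m, h, fun j _ => (le_abs_self _).trans
      ((Finset.single_le_sum (fun k _ => abs_nonneg (y k)) (Finset.mem_univ j)).trans hm)⟩
  have := tendsto_measure_iUnion_atTop (μ := ρ) hmono
  rw [hU] at this
  exact (ENNReal.tendsto_toReal (measure_ne_top _ _)).comp this

end DistributionFunctions

section Frechet

variable {d : ℕ} {ρ : Measure (Fin d → ℝ)} [IsProbabilityMeasure ρ]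

theorem HasFrechetMarginals.continuous_df (h : HasFrechetMarginals ρ) : Continuous (df ρ) :=
  continuous_df_of_continuous_marg fun i => by
    rw [show marg ρ i = frechet from funext (h i)]; exact continuous_frechet

theorem HasFrechetMarginals.df_lt_one (h : HasFrechetMarginals ρ) (hd : 1 ≤ d) (x : Fin d → ℝ) :
    df ρ x < 1 :=
  (df_le_marg x ⟨0, hd⟩).trans_lt ((h _ _).trans_lt (frechet_lt_one _))

theorem HasFrechetMarginals.tendsto_df_const (h : HasFrechetMarginals ρ) :
    Tendsto (fun M : ℝ => df ρ fun _ => M) atTop (𝓝 1) := by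
  have hs : Tendsto (fun M : ℝ => 1 - ∑ _i : Fin d, (1 - frechet M)) atTop (𝓝 1) := by
    have := (tendsto_const_nhds (x := (1 : ℝ))).sub
      (tendsto_finsetSum (Finset.univ : Finset (Fin d)) fun _ _ =>
        (tendsto_const_nhds (x := (1 : ℝ))).sub tendsto_frechet_atTop)
    simpa using this
  refine tendsto_of_tendsto_of_tendsto_of_le_of_le hs tendsto_const_nhds (fun M => ?_)
    fun M => df_le_one _
  have := one_sub_df_le (ρ := ρ) fun _ => M
  simp_rw [h _ _] at this
  linarith

theorem HasFrechetMarginals.df_pos (h : HasFrechetMarginals ρ) (hid : MaxID ρ) {x : Fin d → ℝ}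
    (hx : ∀ i, 0 < x i) : 0 < df ρ x := by
  refine (df_nonneg ρ x).lt_of_ne' fun hzero => ?_
  have hm : ∀ i, ∃ m : ℕ, 0 < df ρ (Function.update (fun _ => (m : ℝ)) i (x i)) := fun i =>
    ((tendsto_df_update i (x i)).eventually_const_lt
      ((frechet_pos (hx i)).trans_eq (h i (x i)).symm)).exists
  choose m hm using hm
  set a : Fin d → ℝ := fun i => df ρ (Function.update (fun _ => (m i : ℝ)) i (x i))
  have hbound : ∀ t : ℝ, 0 < t → 1 ≤ ∑ i, (1 - a i ^ t) := by
    intro t ht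
    obtain ⟨ν, hν, hdf⟩ := hid t ht
    have h1 := one_sub_df_le (ρ := ν) x
    rw [hdf, hzero, Real.zero_rpow ht.ne', sub_zero] at h1
    refine h1.trans (Finset.sum_le_sum fun i _ => ?_)
    have := df_le_marg (ρ := ν) (Function.update (fun _ => (m i : ℝ)) i (x i)) i
    rw [hdf, Function.update_self] at this
    exact sub_le_sub_left this 1
  have hlim : Tendsto (fun t : ℝ => ∑ i, (1 - a i ^ t)) (𝓝[>] 0) (𝓝 0) := by
    have hc : Continuous fun t : ℝ => ∑ i, (1 - a i ^ t) :=
      continuous_finsetSum _ fun i _ =>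
        continuous_const.sub (Real.continuous_const_rpow (hm i).ne')
    simpa using (hc.tendsto 0).mono_left nhdsWithin_le_nhds
  have := ge_of_tendsto hlim (eventually_mem_nhdsWithin.mono fun t ht => hbound t ht)
  linarith

end Frechet

theorem tendsto_mul_one_sub_of_tendsto_pow {a : ℕ → ℝ} (ha0 : ∀ n, 0 ≤ a n)
    {h : ℝ} (hh : 0 < h) (ha : Tendsto (fun n => a n ^ n) atTop (𝓝 h)) :
    Tendsto (fun n : ℕ => (n : ℝ) * (1 - a n)) atTop (𝓝 (-Real.log h)) := by
  have hlog : Tendsto (fun n : ℕ => (n : ℝ) * Real.log (a n)) atTop (𝓝 (Real.log h)) := by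
    have := ha.log hh.ne'
    simpa only [Real.log_pow] using this
  have hpos : ∀ᶠ n in atTop, 0 < a n := by
    filter_upwards [ha.eventually_const_lt hh, eventually_ne_atTop 0] with n hn hn0
    refine (ha0 n).lt_of_ne' fun h0 => ?_
    simp [h0, hn0] at hn
  have hone : Tendsto a atTop (𝓝 1) := by
    have h0 : Tendsto (fun n : ℕ => Real.log (a n)) atTop (𝓝 0) := by
      have := hlog.mul tendsto_inv_atTop_nhds_zero_nat
      rw [mul_zero] at this
      refine this.congr' ?_
      filter_upwards [eventually_ne_atTop 0] with n hn
      field_simp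
    have := (Real.continuous_exp.tendsto 0).comp h0
    rw [Real.exp_zero] at this
    refine this.congr' ?_
    filter_upwards [hpos] with n hn
    exact Real.exp_log hn
  have hlow : Tendsto (fun n : ℕ => a n * -((n : ℝ) * Real.log (a n))) atTop (𝓝 (-Real.log h)) := by
    simpa using hone.mul hlog.neg
  refine tendsto_of_tendsto_of_tendsto_of_le_of_le' hlow hlog.neg ?_ ?_
  · filter_upwards [hpos] with n hn
    have h1 := Real.one_sub_inv_le_log_of_pos hn
    have h2 : a n * (1 - (a n)⁻¹) ≤ a n * Real.log (a n) := mul_le_mul_of_nonneg_left h1 hn.le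
    rw [mul_sub, mul_inv_cancel₀ hn.ne'] at h2
    nlinarith [Nat.cast_nonneg (α := ℝ) n]
  · filter_upwards [hpos] with n hn
    nlinarith [Real.log_le_sub_one_of_pos hn, Nat.cast_nonneg (α := ℝ) n]

/-- Convergence of the masses of the sets `{y | ∃ i, x i < y i}` implies convergence of the masses
of the boxes `(a, b]`, the coordinates being treated one after the other. -/
theorem tendsto_measureReal_of_tendsto_exists_lt {ι : Type*} [Finite ι] (c : ℕ → ℝ)
    (μ : ℕ → Measure (ι → ℝ)) [∀ n, IsFiniteMeasure (μ n)] (υ : Measure (ι → ℝ))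
    (hυ : ∀ x : ι → ℝ, (∀ i, 0 < x i) → υ {y | ∃ i, x i < y i} ≠ ∞)
    (hlim : ∀ x : ι → ℝ, (∀ i, 0 < x i) →
      Tendsto (fun n => c n * (μ n).real {y | ∃ i, x i < y i}) atTop
        (𝓝 (υ.real {y | ∃ i, x i < y i})))
    (a : ι → ℝ) (ha : ∀ i, 0 < a i) {S : Finset ι} (hS : S.Nonempty) :
    ∀ b : ι → ℝ, (∀ i, a i ≤ b i) →
      Tendsto (fun n => c n * (μ n).real {y | (∀ i, y i ≤ b i) ∧ ∀ i ∈ S, a i < y i}) atTop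
        (𝓝 (υ.real {y | (∀ i, y i ≤ b i) ∧ ∀ i ∈ S, a i < y i})) := by
  classical
  have hdiff : ∀ A B : Set (ι → ℝ), B ⊆ A → MeasurableSet B → υ A ≠ ∞ →
      Tendsto (fun n => c n * (μ n).real A) atTop (𝓝 (υ.real A)) →
      Tendsto (fun n => c n * (μ n).real B) atTop (𝓝 (υ.real B)) →
      Tendsto (fun n => c n * (μ n).real (A \ B)) atTop (𝓝 (υ.real (A \ B))) := by
    intro A B hBA hB hA h1 h2
    rw [measureReal_sdiff hBA hB hA]
    have : ∀ n, (μ n).real (A \ B) = (μ n).real A - (μ n).real B :=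
      fun n => measureReal_sdiff hBA hB
    simp_rw [this, mul_sub]
    exact h1.sub h2
  have hEm : ∀ x : ι → ℝ, MeasurableSet {y : ι → ℝ | ∃ i, x i < y i} := fun x => by
    rw [Set.ofPred_exists]
    exact MeasurableSet.iUnion fun i => measurableSet_lt measurable_const (measurable_pi_apply i)
  have hDm : ∀ (S : Finset ι) (b : ι → ℝ),
      MeasurableSet {y : ι → ℝ | (∀ i, y i ≤ b i) ∧ ∀ i ∈ S, a i < y i} := by
    intro S b
    have h1 : MeasurableSet {y : ι → ℝ | ∀ i, y i ≤ b i} := by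
      rw [Set.ofPred_forall]
      exact MeasurableSet.iInter fun i => measurableSet_le (measurable_pi_apply i) measurable_const
    have h2 : MeasurableSet {y : ι → ℝ | ∀ i ∈ S, a i < y i} := by
      have : {y : ι → ℝ | ∀ i ∈ S, a i < y i} = ⋂ i ∈ S, {y | a i < y i} := by ext y; simp
      rw [this]
      exact S.measurableSet_biInter fun i _ =>
        measurableSet_lt measurable_const (measurable_pi_apply i)
    exact h1.inter h2
  have hupd : ∀ (b : ι → ℝ) (j : ι), (∀ i, a i ≤ b i) →
      (∀ i, a i ≤ Function.update b j (a j) i) ∧ Function.update b j (a j) ≤ b := by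
    intro b j hab
    refine ⟨fun i => ?_, update_le_self_iff.2 (hab j)⟩
    rcases eq_or_ne i j with rfl | hij
    · simp
    · simpa [hij] using hab i
  induction hS using Finset.Nonempty.cons_induction with
  | singleton j =>
    intro b hab
    obtain ⟨hau, hub⟩ := hupd b j hab
    have : {y : ι → ℝ | (∀ i, y i ≤ b i) ∧ ∀ i ∈ ({j} : Finset ι), a i < y i} =
        {y | ∃ i, Function.update b j (a j) i < y i} \ {y | ∃ i, b i < y i} := by
      ext y
      simp only [Finset.mem_singleton, forall_eq, Set.mem_ofPred_eq, Set.mem_sdiff, not_exists, not_lt]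
      refine ⟨fun ⟨h1, h2⟩ => ⟨⟨j, by simpa using h2⟩, h1⟩, fun ⟨⟨i, hi⟩, h1⟩ => ⟨h1, ?_⟩⟩
      rcases eq_or_ne i j with rfl | hij
      · simpa using hi
      · rw [Function.update_of_ne hij] at hi
        exact absurd hi (h1 i).not_gt
    rw [this]
    exact hdiff _ _ (fun y ⟨i, hi⟩ => ⟨i, (hub i).trans_lt hi⟩) (hEm _)
      (hυ _ fun i => (ha i).trans_le (hau i)) (hlim _ fun i => (ha i).trans_le (hau i))
      (hlim _ fun i => (ha i).trans_le (hab i))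
  | cons j S hj hS ih =>
    intro b hab
    obtain ⟨hau, hub⟩ := hupd b j hab
    have : {y : ι → ℝ | (∀ i, y i ≤ b i) ∧ ∀ i ∈ Finset.cons j S hj, a i < y i} =
        {y | (∀ i, y i ≤ b i) ∧ ∀ i ∈ S, a i < y i} \
          {y | (∀ i, y i ≤ Function.update b j (a j) i) ∧ ∀ i ∈ S, a i < y i} := by
      ext y
      simp only [Finset.forall_mem_cons, Set.mem_ofPred_eq, Set.mem_sdiff, not_and]
      refine ⟨fun ⟨h1, h2, h3⟩ => ⟨⟨h1, h3⟩, fun h => absurd (h j) (by simpa using h2)⟩,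
        fun ⟨⟨h1, h3⟩, h⟩ => ⟨h1, ?_, h3⟩⟩
      by_contra hlt
      refine h (fun i => ?_) h3
      rcases eq_or_ne i j with rfl | hij
      · simpa using hlt
      · simpa [hij] using h1 i
    rw [this]
    refine hdiff _ _ (fun y hy => ⟨fun i => (hy.1 i).trans (hub i), hy.2⟩) (hDm _ _) ?_
      (ih b hab) (ih _ hau)
    obtain ⟨k, hk⟩ := hS
    exact ne_top_of_le_ne_top (hυ a ha) (measure_mono fun y hy => ⟨k, hy.2 k hk⟩)

theorem tendsto_measureReal_box {ι : Type*} [Fintype ι] [Nonempty ι] (c : ℕ → ℝ)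
    (μ : ℕ → Measure (ι → ℝ)) [∀ n, IsFiniteMeasure (μ n)] (υ : Measure (ι → ℝ))
    (hυ : ∀ x : ι → ℝ, (∀ i, 0 < x i) → υ {y | ∃ i, x i < y i} ≠ ∞)
    (hlim : ∀ x : ι → ℝ, (∀ i, 0 < x i) →
      Tendsto (fun n => c n * (μ n).real {y | ∃ i, x i < y i}) atTop
        (𝓝 (υ.real {y | ∃ i, x i < y i})))
    (J : BoxIntegral.Box ι) (hJ : ∀ i, 0 < J.lower i) :
    Tendsto (fun n => c n * (μ n).real J) atTop (𝓝 (υ.real J)) := by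
  have h := tendsto_measureReal_of_tendsto_exists_lt c μ υ hυ hlim J.lower hJ
    (Finset.univ_nonempty (α := ι)) J.upper fun i => (J.lower_lt_upper i).le
  have hset : (J : Set (ι → ℝ)) =
      {y | (∀ i, y i ≤ J.upper i) ∧ ∀ i ∈ (Finset.univ : Finset ι), J.lower i < y i} := by
    ext y
    simp [BoxIntegral.Box.mem_def, forall_and, and_comm]
  rwa [hset]

/-- Probability integral transform: a continuous cdf pushes its measure to the uniform law. -/
theorem map_cdf_eq_restrict_volume (μ : Measure ℝ) [IsProbabilityMeasure μ]
    (hF : Continuous (cdf μ)) : μ.map (cdf μ) = volume.restrict (Set.Icc 0 1) := by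
  have hprob : IsProbabilityMeasure (μ.map (cdf μ)) :=
    Measure.isProbabilityMeasure_map hF.aemeasurable
  have hfin : IsFiniteMeasure (volume.restrict (Set.Icc (0 : ℝ) 1)) := inferInstance
  have hIoo : ∀ s ∈ Set.Ioo (0 : ℝ) 1, μ (cdf μ ⁻¹' Set.Iic s) = ENNReal.ofReal s := by
    intro s hs
    obtain ⟨t, ht⟩ := mem_range_of_exists_le_of_exists_ge hF
      (((tendsto_cdf_atBot μ).eventually_lt_const hs.1).exists.imp fun _ h => h.le)
      (((tendsto_cdf_atTop μ).eventually_const_lt hs.2).exists.imp fun _ h => h.le)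
    obtain ⟨b, hb⟩ := ((tendsto_cdf_atTop μ).eventually_const_lt hs.2).exists
    set A := cdf μ ⁻¹' Set.Iic s
    have hbdd : BddAbove A := ⟨b, fun x hx => by
      by_contra hlt
      exact absurd ((monotone_cdf μ (not_le.1 hlt).le).trans hx) hb.not_ge⟩
    have hmem : sSup A ∈ A :=
      (isClosed_Iic.preimage hF).csSup_mem ⟨t, ht.le⟩ hbdd
    have hA : A = Set.Iic (sSup A) := by
      ext x
      exact ⟨fun hx => le_csSup hbdd hx, fun hx => (monotone_cdf μ hx).trans hmem⟩
    rw [hA, ← ofReal_cdf]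
    congr 1
    exact le_antisymm hmem (ht.ge.trans (monotone_cdf μ (le_csSup hbdd ht.le)))
  refine Measure.ext_of_Iic _ _ fun s => ?_
  rw [Measure.map_apply hF.measurable measurableSet_Iic, Measure.restrict_apply measurableSet_Iic]
  rcases lt_or_ge s 1 with hs1 | hs1
  · rcases lt_or_ge 0 s with hs0 | hs0
    · rw [hIoo s ⟨hs0, hs1⟩]
      have : Set.Iic s ∩ Set.Icc 0 1 = Set.Icc 0 s := by
        ext x; simp only [Set.mem_inter_iff, Set.mem_Iic, Set.mem_Icc]
        exact ⟨fun h => ⟨h.2.1, h.1⟩, fun h => ⟨h.2, h.1, h.2.trans hs1.le⟩⟩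
      rw [this, Real.volume_Icc, sub_zero]
    · have h0 : μ (cdf μ ⁻¹' Set.Iic s) = 0 := by
        refine le_antisymm (le_of_forall_gt_imp_ge_of_dense fun e he => ?_) zero_le
        have hlim : Tendsto (fun r : ℝ => ENNReal.ofReal r) (𝓝[>] 0) (𝓝 0) := by
          simpa using (ENNReal.continuous_ofReal.tendsto 0).mono_left nhdsWithin_le_nhds
        obtain ⟨r, hre, hr⟩ := ((hlim.eventually_lt_const he).and
          (Ioo_mem_nhdsGT (one_pos (α := ℝ)))).exists
        refine le_trans ?_ hre.le
        rw [← hIoo r hr]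
        exact measure_mono fun x hx => le_trans hx (hs0.trans hr.1.le)
      rw [h0]
      have : Set.Iic s ∩ Set.Icc 0 1 ⊆ {0} := fun x hx =>
        le_antisymm (le_trans hx.1 hs0) hx.2.1
      exact (measure_mono_null this (by simp)).symm
  · have h1 : cdf μ ⁻¹' Set.Iic s = Set.univ :=
      Set.eq_univ_of_forall fun x => (cdf_le_one μ x).trans hs1
    have h2 : Set.Iic s ∩ Set.Icc (0 : ℝ) 1 = Set.Icc 0 1 :=
      Set.inter_eq_right.2 fun x hx => le_trans hx.2 hs1
    rw [h1, h2]
    simp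

theorem mul_setIntegral_Iic_cdf_pow_le (μ : Measure ℝ) [IsProbabilityMeasure μ]
    (hF : Continuous (cdf μ)) (n : ℕ) (t : ℝ) :
    n * ∫ x in Set.Iic t, cdf μ x ^ n ∂μ ≤ cdf μ t ^ n := by
  set p := cdf μ t
  have hp0 : 0 ≤ p := cdf_nonneg μ t
  have hp1 : p ≤ 1 := cdf_le_one μ t
  have hint : Integrable (fun x => cdf μ x ^ n) μ := by
    refine (integrable_const (1 : ℝ)).mono' (hF.pow n).aestronglyMeasurable (ae_of_all _ fun x => ?_)
    rw [Real.norm_of_nonneg (pow_nonneg (cdf_nonneg μ x) n)]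
    exact pow_le_one₀ (cdf_nonneg μ x) (cdf_le_one μ x)
  have hle : ∫ x in Set.Iic t, cdf μ x ^ n ∂μ ≤ p ^ (n + 1) / (n + 1) := by
    calc ∫ x in Set.Iic t, cdf μ x ^ n ∂μ ≤ ∫ x in cdf μ ⁻¹' Set.Iic p, cdf μ x ^ n ∂μ :=
          setIntegral_mono_set hint.integrableOn
            (ae_of_all _ fun x => pow_nonneg (cdf_nonneg μ x) n)
            (ae_of_all _ fun x hx => monotone_cdf μ hx)
      _ = ∫ u in Set.Iic p, u ^ n ∂(μ.map (cdf μ)) :=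
          (setIntegral_map measurableSet_Iic (continuous_pow n).aestronglyMeasurable
            hF.aemeasurable).symm
      _ = ∫ u in (0 : ℝ)..p, u ^ n := by
          rw [map_cdf_eq_restrict_volume μ hF, Measure.restrict_restrict measurableSet_Iic,
            intervalIntegral.integral_of_le hp0, ← integral_Icc_eq_integral_Ioc]
          congr 2
          ext x
          simp only [Set.mem_inter_iff, Set.mem_Iic, Set.mem_Icc]
          exact ⟨fun h => ⟨h.2.1, h.1⟩, fun h => ⟨h.2, h.1, h.2.trans hp1⟩⟩
      _ = p ^ (n + 1) / (n + 1) := by rw [integral_pow]; simp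
  have hpn : p ^ (n + 1) ≤ p ^ n := pow_le_pow_of_le_one hp0 hp1 n.le_succ
  have hpow : 0 ≤ p ^ n := pow_nonneg hp0 n
  have hn : (0 : ℝ) ≤ n := n.cast_nonneg
  calc n * ∫ x in Set.Iic t, cdf μ x ^ n ∂μ ≤ n * (p ^ (n + 1) / (n + 1)) :=
        mul_le_mul_of_nonneg_left hle hn
    _ ≤ p ^ n := by
        rw [← mul_div_assoc, div_le_iff₀ (by positivity)]
        nlinarith

section ContinuousDF

variable {d : ℕ} {ρ : Measure (Fin d → ℝ)} [IsProbabilityMeasure ρ]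

theorem measure_eval_eq_eq_zero (hc : Continuous (df ρ)) (i : Fin d) (t : ℝ) :
    ρ {y | y i = t} = 0 := by
  have hm : ∀ m : ℕ, ρ {y | y i = t ∧ ∀ j, j ≠ i → y j ≤ m} = 0 := by
    intro m
    set u : ℝ → Fin d → ℝ := fun s => Function.update (fun _ => (m : ℝ)) i s
    have hu : Continuous u := continuous_const.update i continuous_id
    have hle : ∀ s < t, ρ.real {y | y i = t ∧ ∀ j, j ≠ i → y j ≤ m} ≤ df ρ (u t) - df ρ (u s) := by
      intro s hs
      have hsub : Set.Iic (u s) ⊆ Set.Iic (u t) :=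
        Set.Iic_subset_Iic.2 (update_le_update_iff.2 ⟨hs.le, fun _ _ => le_rfl⟩)
      rw [df_eq_measureReal_Iic, df_eq_measureReal_Iic,
        ← measureReal_sdiff hsub measurableSet_Iic]
      refine measureReal_mono fun y hy => ⟨le_update_iff.2 ⟨hy.1.le, hy.2⟩, fun h => ?_⟩
      have := (le_update_iff.1 h).1
      rw [hy.1] at this
      exact this.not_gt hs
    have hlim : Tendsto (fun s => df ρ (u t) - df ρ (u s)) (𝓝[<] t) (𝓝 0) := by
      have : Continuous fun s => df ρ (u t) - df ρ (u s) := continuous_const.sub (hc.comp hu)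
      simpa using (this.tendsto t).mono_left nhdsWithin_le_nhds
    have h0 := ge_of_tendsto hlim (eventually_mem_nhdsWithin.mono fun s hs => hle s hs)
    exact (measureReal_eq_zero_iff).1 (le_antisymm h0 measureReal_nonneg)
  refine measure_mono_null (fun y hy => ?_) (measure_iUnion_null hm)
  obtain ⟨m, hm⟩ := exists_nat_ge (∑ j, |y j|)
  exact Set.mem_iUnion.2 ⟨m, hy, fun j _ => (le_abs_self _).trans
    ((Finset.single_le_sum (fun k _ => abs_nonneg (y k)) (Finset.mem_univ j)).trans hm)⟩

theorem ae_pos_of_continuous_df (hc : Continuous (df ρ)) (hs : SupportedOnNonneg ρ) :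
    ∀ᵐ y ∂ρ, ∀ i, 0 < y i := by
  rw [ae_all_iff]
  intro i
  have h1 : ∀ᵐ y ∂ρ, ¬ y i = 0 := by
    rw [ae_iff]; simpa using measure_eval_eq_eq_zero hc i 0
  have h2 : ∀ᵐ y ∂ρ, ¬ ∃ i, y i < 0 := by
    rw [ae_iff]; simpa [SupportedOnNonneg] using hs
  filter_upwards [h1, h2] with y hy1 hy2
  exact lt_of_le_of_ne (not_lt.1 fun h => hy2 ⟨i, h⟩) (Ne.symm hy1)

theorem cdf_map_eval (i : Fin d) (t : ℝ) : cdf (ρ.map fun y => y i) t = marg ρ i t := by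
  have : IsProbabilityMeasure (ρ.map fun y => y i) :=
    Measure.isProbabilityMeasure_map (measurable_pi_apply i).aemeasurable
  rw [cdf_eq_real, map_measureReal_apply (measurable_pi_apply i) measurableSet_Iic]
  rfl

theorem continuous_cdf_map_eval (hc : Continuous (df ρ)) (i : Fin d) :
    Continuous (cdf (ρ.map fun y => y i)) := by
  have : IsProbabilityMeasure (ρ.map fun y => y i) :=
    Measure.isProbabilityMeasure_map (measurable_pi_apply i).aemeasurable
  rw [continuous_iff_continuousAt]
  intro t
  rw [(monotone_cdf _).continuousAt_iff_leftLim_eq_rightLim, StieltjesFunction.rightLim_eq]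
  have h := (cdf (ρ.map fun y => y i)).measure_singleton t
  rw [measure_cdf, Measure.map_apply (measurable_pi_apply i) (measurableSet_singleton t)] at h
  have h0 : ρ ((fun y : Fin d → ℝ => y i) ⁻¹' {t}) = 0 := measure_eval_eq_eq_zero hc i t
  rw [h0, eq_comm, ENNReal.ofReal_eq_zero] at h
  exact le_antisymm ((monotone_cdf _).leftLim_le le_rfl) (by linarith)

theorem mul_setIntegral_marg_pow_le (hc : Continuous (df ρ)) (i : Fin d) (n : ℕ) (t : ℝ) :
    n * ∫ y in {y | y i ≤ t}, marg ρ i (y i) ^ n ∂ρ ≤ marg ρ i t ^ n := by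
  have : IsProbabilityMeasure (ρ.map fun y => y i) :=
    Measure.isProbabilityMeasure_map (measurable_pi_apply i).aemeasurable
  have hF := continuous_cdf_map_eval hc i
  have h := mul_setIntegral_Iic_cdf_pow_le (ρ.map fun y => y i) hF n t
  rw [setIntegral_map (f := fun x => cdf (ρ.map fun y => y i) x ^ n) measurableSet_Iic
    (hF.pow n).aestronglyMeasurable (measurable_pi_apply i).aemeasurable] at h
  simp only [cdf_map_eval] at h
  exact h

end ContinuousDF

/-- Bound on the contribution to the integral of the complement of the box `(ε, M]^d`: points with a
coordinate above `M`, points with a coordinate at most `ε` and another above `δ`, and points with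
all coordinates at most `δ`. -/
theorem mul_setIntegral_nonneg_le {d : ℕ} {ρ : Measure (Fin d → ℝ)} [IsProbabilityMeasure ρ]
    (hc : Continuous (df ρ)) (hs : SupportedOnNonneg ρ) {g : (Fin d → ℝ) → ℝ}
    (hgc : Continuous g) (hgm : Monotone g) (hg0 : ∀ x, 0 ≤ g x) (hg1 : ∀ x, g x ≤ 1)
    {n : ℕ} {C : ℝ} (hC : 0 ≤ C)
    (hdom : ∀ x : Fin d → ℝ, (∀ i, 0 < x i) → g x ≤ C * ∑ i, marg ρ i (x i) ^ n)
    {ε M : ℝ} (hεM : ε < M) (δ : ℝ) :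
    n * ∫ x in {x : Fin d → ℝ | ∀ i, 0 ≤ x i}, g x ∂ρ ≤
      n * (∫ x in (⟨fun _ => ε, fun _ => M, fun _ => hεM⟩ : BoxIntegral.Box (Fin d)), g x ∂ρ) +
        (n * (1 - df ρ fun _ => M) + n * (1 - df ρ fun _ => δ) *
          ∑ i, g (Function.update (fun _ => M) i ε)) + C * ∑ i, marg ρ i δ ^ n := by
  set J : BoxIntegral.Box (Fin d) := ⟨fun _ => ε, fun _ => M, fun _ => hεM⟩
  set K := ∑ i, g (Function.update (fun _ => M) i ε)
  set E : ℝ → Set (Fin d → ℝ) := fun r => {y | ∃ i, r < y i}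
  have hE : ∀ r, MeasurableSet (E r) := fun r => measurableSet_exists_lt fun _ => r
  have hB : ∀ i, MeasurableSet {y : Fin d → ℝ | y i ≤ δ} := fun i =>
    measurableSet_le (measurable_pi_apply i) measurable_const
  have hgi : Integrable g ρ :=
    (integrable_const (1 : ℝ)).mono' hgc.aestronglyMeasurable
      (ae_of_all _ fun x => (Real.norm_of_nonneg (hg0 x)).trans_le (hg1 x))
  have hmi : ∀ i, Integrable (fun y : Fin d → ℝ => marg ρ i (y i) ^ n) ρ := fun i =>
    (integrable_const (1 : ℝ)).mono'
      (((marg_mono i).measurable.comp (measurable_pi_apply i)).pow_const n).aestronglyMeasurable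
      (ae_of_all _ fun x => (Real.norm_of_nonneg (pow_nonneg (marg_nonneg ρ i _) n)).trans_le
        (pow_le_one₀ (marg_nonneg ρ i _) (marg_le_one i _)))
  have hK : 0 ≤ K := Finset.sum_nonneg fun i _ => hg0 _
  have i1 : Integrable ((J : Set (Fin d → ℝ)).indicator g) ρ := hgi.indicator J.measurableSet_coe
  have i2 : Integrable ((E M).indicator fun _ => (1 : ℝ)) ρ :=
    (integrable_const (1 : ℝ)).indicator (hE M)
  have i3 : Integrable ((E δ).indicator fun _ => K) ρ := (integrable_const K).indicator (hE δ)
  have i12 : Integrable (fun x => (J : Set (Fin d → ℝ)).indicator g x +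
      (E M).indicator (fun _ => (1 : ℝ)) x) ρ := i1.add i2
  have i123 : Integrable (fun x => (J : Set (Fin d → ℝ)).indicator g x +
      (E M).indicator (fun _ => (1 : ℝ)) x + (E δ).indicator (fun _ => K) x) ρ := i12.add i3
  have i4' : ∀ i, Integrable ({y | y i ≤ δ}.indicator fun y => marg ρ i (y i) ^ n) ρ :=
    fun i => (hmi i).indicator (hB i)
  have i4 : Integrable (fun x => C * ∑ i, {y | y i ≤ δ}.indicator (fun y => marg ρ i (y i) ^ n) x) ρ :=
    (integrable_finsetSum _ fun i _ => i4' i).const_mul C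
  have hle : ∫ x in {x : Fin d → ℝ | ∀ i, 0 ≤ x i}, g x ∂ρ ≤
      ∫ x, ((J : Set (Fin d → ℝ)).indicator g x + (E M).indicator (fun _ => (1 : ℝ)) x +
        (E δ).indicator (fun _ => K) x +
        C * ∑ i, {y | y i ≤ δ}.indicator (fun y => marg ρ i (y i) ^ n) x) ∂ρ := by
    refine (setIntegral_le_integral hgi (ae_of_all _ hg0)).trans
      (integral_mono_ae hgi (i123.add i4) ?_)
    filter_upwards [ae_pos_of_continuous_df hc hs] with x hx
    have n1 : 0 ≤ (J : Set (Fin d → ℝ)).indicator g x := Set.indicator_nonneg (fun y _ => hg0 y) x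
    have n2 : 0 ≤ (E M).indicator (fun _ => (1 : ℝ)) x :=
      Set.indicator_nonneg (fun _ _ => zero_le_one) x
    have n3 : 0 ≤ (E δ).indicator (fun _ => K) x := Set.indicator_nonneg (fun _ _ => hK) x
    have n4 : 0 ≤ C * ∑ i, {y | y i ≤ δ}.indicator (fun y => marg ρ i (y i) ^ n) x :=
      mul_nonneg hC (Finset.sum_nonneg fun i _ =>
        Set.indicator_nonneg (fun y _ => pow_nonneg (marg_nonneg ρ i _) n) x)
    by_cases hxM : x ∈ E M
    · rw [Set.indicator_of_mem hxM] at n2 ⊢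
      linarith [hg1 x]
    have hxM' : ∀ i, x i ≤ M := fun i => not_lt.1 fun h => hxM ⟨i, h⟩
    by_cases hxJ : x ∈ (J : Set (Fin d → ℝ))
    · rw [Set.indicator_of_mem hxJ] at n1 ⊢
      linarith
    obtain ⟨i, hi⟩ : ∃ i, x i ≤ ε := by
      by_contra! h
      exact hxJ fun i => ⟨h i, hxM' i⟩
    by_cases hxδ : x ∈ E δ
    · rw [Set.indicator_of_mem hxδ] at n3 ⊢
      have : g x ≤ K := (hgm (le_update_iff.2 ⟨hi, fun j _ => hxM' j⟩)).trans
        (Finset.single_le_sum (f := fun i => g (Function.update (fun _ => M) i ε))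
          (fun j _ => hg0 _) (Finset.mem_univ i))
      linarith
    have hxδ' : ∀ i, x ∈ {y : Fin d → ℝ | y i ≤ δ} := fun i => not_lt.1 fun h => hxδ ⟨i, h⟩
    have h4 : ∑ i, {y | y i ≤ δ}.indicator (fun y => marg ρ i (y i) ^ n) x =
        ∑ i, marg ρ i (x i) ^ n :=
      Finset.sum_congr rfl fun i _ => Set.indicator_of_mem (hxδ' i) _
    rw [h4]
    linarith [hdom x hx]
  rw [integral_add i123 i4, integral_add i12 i3, integral_add i1 i2,
    integral_indicator J.measurableSet_coe, integral_indicator (hE M), integral_indicator (hE δ),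
    setIntegral_const, setIntegral_const, integral_const_mul, integral_finsetSum _ fun i _ => i4' i,
    measureReal_exists_lt, measureReal_exists_lt] at hle
  simp_rw [integral_indicator (hB _)] at hle
  have hsum : C * ∑ i, n * ∫ y in {y | y i ≤ δ}, marg ρ i (y i) ^ n ∂ρ ≤ C * ∑ i, marg ρ i δ ^ n :=
    mul_le_mul_of_nonneg_left
      (Finset.sum_le_sum fun i _ => mul_setIntegral_marg_pow_le hc i n δ) hC
  rw [← Finset.mul_sum] at hsum
  have := mul_le_mul_of_nonneg_left hle n.cast_nonneg (α := ℝ)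
  simp only [smul_eq_mul, mul_one] at this
  linarith

/-- If `F_n ^ n` converges to a df with unit Fréchet marginals, the powers of the marginals of `F_n`
are eventually bounded by a function that vanishes at the origin. -/
theorem eventually_marg_pow_le {d : ℕ} {ρ : ℕ → Measure (Fin d → ℝ)}
    [∀ n, IsProbabilityMeasure (ρ n)] {ρH : Measure (Fin d → ℝ)} [IsProbabilityMeasure ρH]
    (hHm : HasFrechetMarginals ρH) (hHpos : ∀ x : Fin d → ℝ, (∀ i, 0 < x i) → 0 < df ρH x)
    (hlim : ∀ x : Fin d → ℝ, (∀ i, 0 < x i) →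
      Tendsto (fun n : ℕ => n * (1 - df (ρ n) x)) atTop (𝓝 (-Real.log (df ρH x))))
    (i : Fin d) {t : ℝ} (ht : 0 < t) :
    ∀ᶠ n in atTop, marg (ρ n) i t ^ n ≤ Real.exp (1 - 1 / t) := by
  have htail : Tendsto (fun M : ℝ => -Real.log (df ρH fun _ => M)) atTop (𝓝 0) := by
    simpa using (hHm.tendsto_df_const.log one_ne_zero).neg
  obtain ⟨M, hM, hM0⟩ := ((htail.eventually_lt_const (half_pos one_pos)).and
    (eventually_gt_atTop 0)).exists
  set u : Fin d → ℝ := Function.update (fun _ => M) i t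
  have hu : ∀ j, 0 < u j := fun j => by
    rcases eq_or_ne j i with rfl | hj
    · simpa [u] using ht
    · simpa [u, hj] using hM0
  have hlog : 1 / t ≤ -Real.log (df ρH u) := by
    have h1 : df ρH u ≤ Real.exp (-(1 / t)) := by
      have := df_le_marg (ρ := ρH) u i
      rwa [hHm, show u i = t by simp [u], frechet, if_pos ht] at this
    have := Real.log_le_log (hHpos u hu) h1
    rw [Real.log_exp] at this
    linarith
  filter_upwards [(hlim u hu).eventually_const_lt (show 1 / t - 1 / 2 < _ by linarith),
    (hlim (fun _ => M) fun _ => hM0).eventually_lt_const hM] with n h1 h2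
  have hsub : {y : Fin d → ℝ | y i ≤ t} ⊆ Set.Iic u ∪ {y | ∃ j, M < y j} := by
    intro y hy
    by_cases h : ∃ j, M < y j
    · exact Or.inr h
    · push Not at h
      exact Or.inl (le_update_iff.2 ⟨hy, fun j _ => h j⟩)
  have hmarg : marg (ρ n) i t ≤ df (ρ n) u + (1 - df (ρ n) fun _ => M) := by
    rw [← measureReal_exists_lt]
    exact (measureReal_mono hsub).trans (measureReal_union_le _ _)
  have hexp : marg (ρ n) i t ≤ Real.exp (-(1 - marg (ρ n) i t)) := by
    have := Real.add_one_le_exp (-(1 - marg (ρ n) i t))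
    linarith
  calc marg (ρ n) i t ^ n ≤ Real.exp (-(1 - marg (ρ n) i t)) ^ n :=
        pow_le_pow_left₀ (marg_nonneg _ _ _) hexp n
    _ = Real.exp (-(n * (1 - marg (ρ n) i t))) := by rw [← Real.exp_nat_mul]; ring_nf
    _ ≤ Real.exp (1 - 1 / t) := by
        rw [Real.exp_le_exp]
        have := mul_le_mul_of_nonneg_left hmarg n.cast_nonneg (α := ℝ)
        linarith

/-- (Proposition on `λ`.) Let `F_n, G_n` be continuous dfs of probability
measures `ρ n, τ n` on `[0,∞)^d` with `F_n^n → H`, `G_n^n → Q` pointwise on `[0,∞)^d`,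
where `H, Q` are max-id with unit Fréchet marginals, and let `υ` be an exponent measure
of `H`. If `G_n^n ≤ C₁ Σ_i F_{ni}^n` on `(0,∞)^d` for all large `n`, then
`lim_n n ∫_{[0,∞)^d} G_n^n dρ_n = ∫_{(0,∞)^d} Q dυ`. -/
theorem stmt17 {d : ℕ} (hd : 1 ≤ d)
    (ρ τ : ℕ → Measure (Fin d → ℝ))
    (hρ : ∀ n, IsProbabilityMeasure (ρ n)) (hτ : ∀ n, IsProbabilityMeasure (τ n))
    (hρsupp : ∀ n, SupportedOnNonneg (ρ n)) (hτsupp : ∀ n, SupportedOnNonneg (τ n))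
    (hρcont : ∀ n, Continuous (df (ρ n))) (hτcont : ∀ n, Continuous (df (τ n)))
    (ρH ρQ : Measure (Fin d → ℝ))
    [IsProbabilityMeasure ρH] [IsProbabilityMeasure ρQ]
    (hHm : HasFrechetMarginals ρH) (hQm : HasFrechetMarginals ρQ)
    (hHid : MaxID ρH) (hQid : MaxID ρQ)
    (hFconv : ∀ x : Fin d → ℝ, (∀ i, 0 ≤ x i) →
      Tendsto (fun n : ℕ => (df (ρ n) x) ^ n) atTop (𝓝 (df ρH x)))
    (hGconv : ∀ x : Fin d → ℝ, (∀ i, 0 ≤ x i) →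
      Tendsto (fun n : ℕ => (df (τ n) x) ^ n) atTop (𝓝 (df ρQ x)))
    (υ : Measure (Fin d → ℝ)) (hexp : IsExponentMeasure ρH υ)
    (C₁ : ℝ) (hC₁ : 0 < C₁) (N : ℕ)
    (hdom : ∀ n ≥ N, ∀ x : Fin d → ℝ, (∀ i, 0 < x i) →
      (df (τ n) x) ^ n ≤ C₁ * ∑ i, (marg (ρ n) i (x i)) ^ n) :
    Tendsto
      (fun n : ℕ =>
        (n : ℝ) * ∫ x in {x : Fin d → ℝ | ∀ i, 0 ≤ x i}, (df (τ n) x) ^ n ∂(ρ n))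
      atTop (𝓝 (∫ x in posOrthant d, df ρQ x ∂υ)) := by
  have : Nonempty (Fin d) := ⟨⟨0, hd⟩⟩
  have hHpos : ∀ x : Fin d → ℝ, (∀ i, 0 < x i) → 0 < df ρH x := fun x hx => hHm.df_pos hHid hx
  have hmass : ∀ x : Fin d → ℝ, (∀ i, 0 < x i) →
      Tendsto (fun n : ℕ => n * (1 - df (ρ n) x)) atTop (𝓝 (-Real.log (df ρH x))) := fun x hx =>
    tendsto_mul_one_sub_of_tendsto_pow (fun n => df_nonneg _ _) (hHpos x hx)
      (hFconv x fun i => (hx i).le)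
  have hυE : ∀ x : Fin d → ℝ, (∀ i, 0 < x i) → υ {y | ∃ i, x i < y i} ≠ ∞ := by
    intro x hx htop
    have h := hexp x hx
    rw [htop, ENNReal.toReal_top] at h
    linarith [Real.log_neg (hHpos x hx) (hHm.df_lt_one hd x)]
  have hεM : ∀ k : ℕ, ((k : ℝ) + 2)⁻¹ < (k : ℝ) + 2 := fun k => by
    have h2 : (1 : ℝ) < (k : ℝ) + 2 := by linarith [k.cast_nonneg (α := ℝ)]
    exact (inv_lt_one_of_one_lt₀ h2).trans h2
  set A : ℕ → BoxIntegral.Box (Fin d) := fun k =>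
    ⟨fun _ => ((k : ℝ) + 2)⁻¹, fun _ => (k : ℝ) + 2, fun _ => hεM k⟩
  have hε0 : ∀ k : ℕ, 0 < ((k : ℝ) + 2)⁻¹ := fun k => by positivity
  have hQc : Continuous (df ρQ) := hQm.continuous_df
  set g : ℕ → (Fin d → ℝ) → ℝ := fun n x => df (τ n) x ^ n
  have hgc : ∀ n, Continuous (g n) := fun n => (hτcont n).pow n
  have hgm : ∀ n, Monotone (g n) := fun n _ _ h => pow_le_pow_left₀ (df_nonneg _ _) (df_mono h) n
  have hg0 : ∀ n x, 0 ≤ g n x := fun n x => pow_nonneg (df_nonneg _ _) n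
  have hg1 : ∀ n x, g n x ≤ 1 := fun n x => pow_le_one₀ (df_nonneg _ _) (df_le_one _)
  have hgi : ∀ n, Integrable (g n) (ρ n) := fun n =>
    (integrable_const (1 : ℝ)).mono' (hgc n).aestronglyMeasurable
      (ae_of_all _ fun x => (Real.norm_of_nonneg (hg0 n x)).trans_le (hg1 n x))
  have hAυ : ∀ k, υ (A k) ≠ ∞ := fun k =>
    ne_top_of_le_ne_top (hυE (A k).lower fun _ => hε0 k)
      (measure_mono fun y hy => ⟨⟨0, hd⟩, (hy ⟨0, hd⟩).1⟩)
  have hJ : ∀ k, Tendsto (fun n : ℕ => (n : ℝ) * ∫ x in A k, g n x ∂(ρ n)) atTop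
      (𝓝 (∫ x in A k, df ρQ x ∂υ)) := by
    intro k
    refine tendsto_setIntegral_box (A k) (fun n => n) (fun n => n.cast_nonneg) ρ υ (hAυ k) g (df ρQ)
      hgm (fun n => (hgi n).integrableOn) df_mono hQc
      (fun x hx => hGconv x fun i => (hε0 k).le.trans (hx.1 i)) fun J hJ => ?_
    refine tendsto_measureReal_box (fun n => (n : ℝ)) ρ υ hυE (fun x hx => ?_) J fun i =>
      (hε0 k).trans_le ((BoxIntegral.Box.antitone_lower hJ) i)
    simp_rw [measureReal_exists_lt]
    rw [show υ.real {y | ∃ i, x i < y i} = _ from hexp x hx]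
    exact hmass x hx
  have hAnonneg : ∀ k, (A k : Set (Fin d → ℝ)) ⊆ {x | ∀ i, 0 ≤ x i} := fun k x hx i =>
    ((hε0 k).trans (hx i).1).le
  have hJI : ∀ (k n : ℕ), (n : ℝ) * ∫ x in A k, g n x ∂(ρ n) ≤
      n * ∫ x in {x : Fin d → ℝ | ∀ i, 0 ≤ x i}, g n x ∂(ρ n) := fun k n =>
    mul_le_mul_of_nonneg_left (setIntegral_mono_set (hgi n).integrableOn
      (ae_of_all _ (hg0 n)) (ae_of_all _ (hAnonneg k))) n.cast_nonneg
  have hMtop : Tendsto (fun k : ℕ => (k : ℝ) + 2) atTop atTop :=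
    tendsto_atTop_add_const_right _ _ tendsto_natCast_atTop_atTop
  have hεlim : Tendsto (fun k : ℕ => ((k : ℝ) + 2)⁻¹) atTop (𝓝 0) :=
    tendsto_inv_atTop_zero.comp hMtop
  have hIJ : ∀ η > 0, ∀ᶠ k in atTop, ∀ᶠ n : ℕ in atTop,
      (n : ℝ) * ∫ x in {x : Fin d → ℝ | ∀ i, 0 ≤ x i}, g n x ∂(ρ n) ≤
        n * (∫ x in A k, g n x ∂(ρ n)) + η := by
    intro η hη
    obtain ⟨δ, hδ, hδ0⟩ : ∃ δ : ℝ, C₁ * ∑ _i : Fin d, Real.exp (1 - 1 / δ) < η / 2 ∧ 0 < δ := by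
      have hexp0 : Tendsto (fun δ : ℝ => Real.exp (1 - 1 / δ)) (𝓝[>] 0) (𝓝 0) := by
        have h1 : Tendsto (fun δ : ℝ => 1 - 1 / δ) (𝓝[>] 0) atBot := by
          simp_rw [one_div, sub_eq_add_neg]
          exact tendsto_atBot_add_const_left _ _
            (tendsto_neg_atTop_atBot.comp tendsto_inv_nhdsGT_zero)
        exact Real.tendsto_exp_atBot.comp h1
      have h2 := (tendsto_finsetSum (Finset.univ : Finset (Fin d)) fun _ _ => hexp0).const_mul C₁
      rw [Finset.sum_const_zero, mul_zero] at h2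
      exact ((h2.eventually_lt_const (half_pos hη)).and eventually_mem_nhdsWithin).exists
    have hmarg : ∀ᶠ n in atTop, C₁ * ∑ i, marg (ρ n) i δ ^ n ≤ η / 2 := by
      filter_upwards [eventually_all.2 fun i => eventually_marg_pow_le hHm hHpos hmass i hδ0]
        with n hn
      exact (mul_le_mul_of_nonneg_left (Finset.sum_le_sum fun i _ => hn i) hC₁.le).trans hδ.le
    have hQ0 : ∀ i, Tendsto (fun k : ℕ =>
        df ρQ (Function.update (fun _ => (k : ℝ) + 2) i ((k : ℝ) + 2)⁻¹)) atTop (𝓝 0) := by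
      intro i
      have hf : Tendsto (fun k : ℕ => frechet ((k : ℝ) + 2)⁻¹) atTop (𝓝 0) := by
        have := (continuous_frechet.tendsto 0).comp hεlim
        rwa [show frechet 0 = 0 by simp [frechet]] at this
      refine squeeze_zero (fun _ => df_nonneg _ _) (fun k => ?_) hf
      have := df_le_marg (ρ := ρQ) (Function.update (fun _ => (k : ℝ) + 2) i ((k : ℝ) + 2)⁻¹) i
      rwa [hQm, Function.update_self] at this
    have he : Tendsto (fun k : ℕ => -Real.log (df ρH fun _ => (k : ℝ) + 2) +
        -Real.log (df ρH fun _ => δ) *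
          ∑ i, df ρQ (Function.update (fun _ => (k : ℝ) + 2) i ((k : ℝ) + 2)⁻¹)) atTop (𝓝 0) := by
      have h1 := ((hHm.tendsto_df_const.comp hMtop).log one_ne_zero).neg
      have h2 := (tendsto_finsetSum Finset.univ fun i _ => hQ0 i).const_mul
        (-Real.log (df ρH fun _ => δ))
      simpa using h1.add h2
    filter_upwards [he.eventually_lt_const (half_pos hη)] with k hk
    have hupd : ∀ i j : Fin d, 0 ≤ Function.update (fun _ => (k : ℝ) + 2) i ((k : ℝ) + 2)⁻¹ j := by
      intro i j
      rcases eq_or_ne j i with rfl | hj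
      · simpa using (hε0 k).le
      · simp only [Function.update_of_ne hj]; positivity
    have hlim := (hmass (fun _ => (k : ℝ) + 2) fun _ => by positivity).add
      ((hmass (fun _ => δ) fun _ => hδ0).mul
        (tendsto_finsetSum Finset.univ fun i _ => hGconv _ (hupd i)))
    filter_upwards [hlim.eventually_lt_const hk, hmarg, eventually_ge_atTop N] with n h1 h2 hn
    have h3 := mul_setIntegral_nonneg_le (hρcont n) (hρsupp n) (hgc n) (hgm n) (hg0 n) (hg1 n)
      hC₁.le (hdom n hn) (hεM k) δ
    linarith
  have hLlim : Tendsto (fun k => ∫ x in A k, df ρQ x ∂υ) atTop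
      (𝓝 (∫ x in posOrthant d, df ρQ x ∂υ)) := by
    have hpos : MeasurableSet (posOrthant d) := by
      have : posOrthant d = ⋂ i, {x : Fin d → ℝ | 0 < x i} := by ext; simp [posOrthant]
      rw [this]
      exact MeasurableSet.iInter fun i => measurableSet_lt measurable_const (measurable_pi_apply i)
    have hcover : AECover (υ.restrict (posOrthant d)) atTop fun k => (A k : Set (Fin d → ℝ)) := by
      refine ⟨(ae_restrict_iff' hpos).2 (ae_of_all _ fun x hx => ?_),
        fun k => (A k).measurableSet_coe⟩
      exact eventually_all.2 fun i => (hεlim.eventually_lt_const (hx i)).and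
        (hMtop.eventually_ge_atTop (x i))
    have hres : ∀ k, (υ.restrict (posOrthant d)).restrict (A k) = υ.restrict (A k) := fun k =>
      Measure.restrict_restrict_of_subset fun x hx i => (hε0 k).trans (hx i).1
    obtain ⟨k₀, hk₀⟩ := (hIJ 1 one_pos).exists
    have hbound : ∀ k, ∫ x in A k, df ρQ x ∂υ ≤ (∫ x in A k₀, df ρQ x ∂υ) + 1 := fun k =>
      le_of_tendsto_of_tendsto (hJ k) ((hJ k₀).add_const 1)
        (hk₀.mono fun n hn => (hJI k n).trans hn)
    have hint : Integrable (df ρQ) (υ.restrict (posOrthant d)) := by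
      refine hcover.integrable_of_integral_bounded_of_nonneg_ae ((∫ x in A k₀, df ρQ x ∂υ) + 1)
        (fun k => ?_) (ae_of_all _ fun x => df_nonneg _ _) (Eventually.of_forall fun k => ?_)
      · rw [IntegrableOn, hres]
        refine (integrableOn_const (C := (1 : ℝ)) (hAυ k)).mono' hQc.aestronglyMeasurable
          (ae_of_all _ fun x => ?_)
        exact (Real.norm_of_nonneg (df_nonneg _ _)).trans_le (df_le_one x)
      · rw [hres]; exact hbound k
    simpa only [hres] using hcover.integral_tendsto_of_countably_generated hint
  rw [Metric.tendsto_atTop']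
  intro η hη
  obtain ⟨k, hk1, hk2⟩ := ((hIJ (η / 3) (by positivity)).and
    (hLlim.eventually (Metric.ball_mem_nhds _ (show 0 < η / 3 by positivity)))).exists
  rw [Real.dist_eq, abs_lt] at hk2
  obtain ⟨n₀, hn₀⟩ := eventually_atTop.1 (hk1.and
    ((hJ k).eventually (Metric.ball_mem_nhds _ (show 0 < η / 3 by positivity))))
  refine ⟨n₀, fun n hn => ?_⟩
  obtain ⟨h1, h2⟩ := hn₀ n hn.le
  rw [Real.dist_eq, abs_lt] at h2
  rw [Real.dist_eq, abs_lt]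
  constructor <;> linarith [hJI k n]
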